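/- arXiv:1504.01790 — 3 statements merged into one kernel-verified Lean document; each statement's English description precedes it below -/
import Mathlib

section
/- Let X be an infinite topological space with nh(X) ≤ 2^(c(X)·χ(X)). Then |X| ≤ 2^(c(X)·χ(X)). -/
open Cardinal Set

/-- A nonempty subset `A` of a topological space is finitely non-Hausdorff if for every
nonempty finite subset `F` of `A` and every choice of open neighborhoods of the points
of `F`, the intersection of these neighborhoods is nonempty. -/
def FinNonHausdorff (X : Type*) [TopologicalSpace X] (A : Set X) : Prop :=
  A.Nonempty ∧ ∀ F : Finset X, (F : Set X) ⊆ A → F.Nonempty →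
    ∀ U : X → Set X, (∀ x ∈ F, IsOpen (U x) ∧ x ∈ U x) →
      (⋂ x ∈ F, U x).Nonempty

/-- A maximal finitely non-Hausdorff subset. -/
def MaxFinNonHausdorff (X : Type*) [TopologicalSpace X] (A : Set X) : Prop :=
  FinNonHausdorff X A ∧ ∀ B : Set X, FinNonHausdorff X B → A ⊆ B → A = B

/-- The non-Hausdorff number `nh(X)`. -/
noncomputable def nh (X : Type*) [TopologicalSpace X] : Cardinal :=
  1 + ⨆ A : {A : Set X // FinNonHausdorff X A}, #A.1

/-- A nonempty subset `A` is finitely non-Urysohn if for every nonempty finite subset `F`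
of `A` and every choice of open neighborhoods of the points of `F`, the intersection of
the closures of these neighborhoods is nonempty. -/
def FinNonUrysohn (X : Type*) [TopologicalSpace X] (A : Set X) : Prop :=
  A.Nonempty ∧ ∀ F : Finset X, (F : Set X) ⊆ A → F.Nonempty →
    ∀ U : X → Set X, (∀ x ∈ F, IsOpen (U x) ∧ x ∈ U x) →
      (⋂ x ∈ F, closure (U x)).Nonempty

/-- The non-Urysohn number `nu(X)`. -/
noncomputable def nu (X : Type*) [TopologicalSpace X] : Cardinal :=
  1 + ⨆ A : {A : Set X // FinNonUrysohn X A}, #A.1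

/-- The θ-closure of the singleton `{x}`. -/
def thetaClosSingleton (X : Type*) [TopologicalSpace X] (x : X) : Set X :=
  {y | ∀ U : Set X, IsOpen U → y ∈ U → x ∈ closure U}

/-- The non-Urysohn number of `X` with respect to singletons, `nu_s(X)`. -/
noncomputable def nuS (X : Type*) [TopologicalSpace X] : Cardinal :=
  1 + ⨆ x : X, #(thetaClosSingleton X x)

/-- The cellularity `c(X)`. -/
noncomputable def cellularity (X : Type*) [TopologicalSpace X] : Cardinal :=
  ℵ₀ + ⨆ 𝒰 : {𝒰 : Set (Set X) //
      (∀ U ∈ 𝒰, IsOpen U ∧ U.Nonempty) ∧ 𝒰.PairwiseDisjoint id}, #𝒰.1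

/-- The character `χ(X)`. -/
noncomputable def character (X : Type*) [TopologicalSpace X] : Cardinal :=
  ⨆ x : X, sInf {c : Cardinal | ∃ B : Set (Set X), #B = c ∧
    (∀ U ∈ B, IsOpen U ∧ x ∈ U) ∧ ∀ V : Set X, IsOpen V → x ∈ V → ∃ U ∈ B, U ⊆ V}

/-- The spread `s(X)`. -/
noncomputable def spread (X : Type*) [TopologicalSpace X] : Cardinal :=
  ℵ₀ + ⨆ D : {D : Set X // DiscreteTopology D}, #D.1

/-- The pseudocharacter `ψ(X)` of a `T₁` space. -/
noncomputable def pseudoCharacter (X : Type*) [TopologicalSpace X] : Cardinal :=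
  ⨆ x : X, sInf {c : Cardinal | ∃ S : Set (Set X), #S = c ∧
    (∀ U ∈ S, IsOpen U) ∧ ⋂₀ S = {x}}

universe u v

/-- Zorn's lemma for predicates on sets determined by the finite subsets. -/
theorem exists_maximal_forall_finset {α : Type*} (P : Finset α → Prop) (h : P ∅) :
    ∃ A : Set α, Maximal (fun B : Set α => ∀ F : Finset α, (F : Set α) ⊆ B → P F) A := by
  have hfc : Order.IsOfFiniteCharacter
      {B : Set α | ∀ F : Finset α, (F : Set α) ⊆ B → P F} := by
    refine fun B => ⟨fun hB C hC _ F hF => hB F (hF.trans hC), fun hB F hF => ?_⟩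
    exact hB F hF F.finite_toSet F subset_rfl
  obtain ⟨A, -, hA⟩ := hfc.exists_maximal (x := ∅) (by
    intro F hF
    obtain rfl : F = ∅ := by simpa using hF
    exact h)
  exact ⟨A, hA⟩

theorem mk_le_cellularity {X : Type*} [TopologicalSpace X] {𝒰 : Set (Set X)}
    (ho : ∀ U ∈ 𝒰, IsOpen U ∧ U.Nonempty) (hd : 𝒰.PairwiseDisjoint id) :
    #𝒰 ≤ cellularity X :=
  (le_ciSup (f := fun 𝒰 : {𝒰 : Set (Set X) //
      (∀ U ∈ 𝒰, IsOpen U ∧ U.Nonempty) ∧ 𝒰.PairwiseDisjoint id} => #𝒰.1)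
    Cardinal.bddAbove_of_small ⟨𝒰, ho, hd⟩).trans (self_le_add_left _ _)

theorem FinNonHausdorff.mk_le_nh {X : Type*} [TopologicalSpace X] {A : Set X}
    (hA : FinNonHausdorff X A) : #A ≤ nh X :=
  (le_ciSup (f := fun A : {A : Set X // FinNonHausdorff X A} => #A.1)
    Cardinal.bddAbove_of_small ⟨A, hA⟩).trans (self_le_add_left _ _)

/-- Every family of open sets has a subfamily of size at most the cellularity whose union is dense
in the union of the family. -/
theorem exists_subset_mk_le_cellularity {X : Type u} [TopologicalSpace X] {J : Type v}
    (W : J → Set X) (K : Set J) (hW : ∀ j ∈ K, IsOpen (W j)) :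
    ∃ G ⊆ K, lift.{u} #G ≤ lift.{v} (cellularity X) ∧ ∀ j ∈ K, W j ⊆ closure (⋃ i ∈ G, W i) := by
  obtain ⟨𝒰, h𝒰, hmax⟩ := exists_maximal_forall_finset
    (fun F : Finset (Set X) => (∀ U ∈ F, IsOpen U ∧ U.Nonempty ∧ ∃ j ∈ K, U ⊆ W j) ∧
      (F : Set (Set X)).PairwiseDisjoint id) (by simp)
  have h1 : ∀ U ∈ 𝒰, IsOpen U ∧ U.Nonempty ∧ ∃ j ∈ K, U ⊆ W j := fun U hU =>
    (h𝒰 {U} (by simpa using hU)).1 U (by simp)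
  have h2 : 𝒰.PairwiseDisjoint id := by
    classical
    intro U hU V hV hne
    exact (h𝒰 {U, V} (by simp [Set.insert_subset_iff, hU, hV])).2 (by simp) (by simp) hne
  choose j hjK hj using fun U : 𝒰 => (h1 U U.2).2.2
  refine ⟨Set.range j, Set.range_subset_iff.2 hjK, ?_, fun k hk x hx => ?_⟩
  · exact mk_range_le_lift.trans (lift_le.2
      (mk_le_cellularity (fun U hU => ⟨(h1 U hU).1, (h1 U hU).2.1⟩) h2))
  · by_contra hxc
    set O := W k \ closure (⋃ i ∈ Set.range j, W i) with hO
    have hOo : IsOpen O := (hW k hk).sdiff isClosed_closure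
    have hOd : ∀ U ∈ 𝒰, Disjoint O U := fun U hU => by
      refine Set.disjoint_left.2 fun y hy hyU => hy.2 (subset_closure ?_)
      exact Set.mem_biUnion (Set.mem_range_self ⟨U, hU⟩) (hj ⟨U, hU⟩ hyU)
    have hmem : O ∈ 𝒰 := by
      refine hmax (y := insert O 𝒰) ?_ (Set.subset_insert _ _) (Set.mem_insert _ _)
      intro F hF
      refine ⟨fun U hU => ?_, ?_⟩
      · obtain rfl | hU := hF hU
        · exact ⟨hOo, ⟨x, hx, hxc⟩, k, hk, Set.sdiff_subset⟩
        · exact h1 U hU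
      · exact (h2.insert fun U hU _ => hOd U hU).subset hF
    exact Set.disjoint_left.1 (hOd O hmem) ⟨hx, hxc⟩ ⟨hx, hxc⟩

/-- A set closed under `2 ^ κ` many `κ`-ary operations, of size at most `2 ^ κ`. -/
theorem exists_closed_under_mk_le {X S I : Type u} [Infinite I] [Nonempty X]
    (hS : #S ≤ 2 ^ #I) (op : S → (I → X) → X) :
    ∃ Y : Set X, Y.Nonempty ∧ #Y ≤ 2 ^ #I ∧ ∀ s f, (∀ i, f i ∈ Y) → op s f ∈ Y := by
  let β : Option S → Type u := fun o => o.elim PEmpty fun _ => I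
  let ev : WType β → X := fun w => w.elim X fun ⟨o, f⟩ =>
    match o, f with
    | none, _ => Classical.arbitrary X
    | some s, f => op s f
  have hI : ℵ₀ ≤ #I := aleph0_le_mk I
  have h2 : ℵ₀ ≤ (2 : Cardinal.{u}) ^ #I := hI.trans (cantor _).le
  refine ⟨Set.range ev, ⟨_, ⟨WType.mk none PEmpty.elim, rfl⟩⟩, ?_, fun s f hf => ?_⟩
  · refine mk_range_le.trans (WType.cardinalMk_le_of_le ?_)
    refine (sum_le_mk_mul_iSup _).trans ?_
    refine (mul_le_mul' (b := (2 : Cardinal.{u}) ^ #I) (d := (2 : Cardinal.{u}) ^ #I) ?_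
      (ciSup_le' fun o => ?_)).trans (mul_eq_self h2).le
    · rw [mk_option]
      exact add_le_of_le h2 hS (one_le_aleph0.trans h2)
    · cases o with
      | none => simpa [β] using one_le_aleph0.trans h2
      | some s => simp only [β, Option.elim]; rw [← power_mul, mul_eq_self hI]
  · choose g hg using hf
    refine ⟨WType.mk (some s) g, ?_⟩
    change op s (fun i => ev (g i)) = _
    simp_rw [hg]

theorem exists_nhds_basis_mk_le_character {X : Type*} [TopologicalSpace X] (x : X) :
    ∃ B : Set (Set X), #B ≤ character X ∧ (∀ U ∈ B, IsOpen U ∧ x ∈ U) ∧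
      ∀ V : Set X, IsOpen V → x ∈ V → ∃ U ∈ B, U ⊆ V := by
  let C (x : X) : Set Cardinal := {c | ∃ B : Set (Set X), #B = c ∧
    (∀ U ∈ B, IsOpen U ∧ x ∈ U) ∧ ∀ V : Set X, IsOpen V → x ∈ V → ∃ U ∈ B, U ⊆ V}
  obtain ⟨B, hB, hB'⟩ : sInf (C x) ∈ C x := csInf_mem
    ⟨_, {U | IsOpen U ∧ x ∈ U}, rfl, fun U hU => hU, fun V hV hx => ⟨V, ⟨hV, hx⟩, subset_rfl⟩⟩
  exact ⟨B, hB.trans_le (le_ciSup (f := fun x => sInf (C x)) Cardinal.bddAbove_of_small x), hB'⟩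

theorem one_le_character (X : Type*) [TopologicalSpace X] [Nonempty X] : 1 ≤ character X := by
  obtain ⟨x⟩ := ‹Nonempty X›
  obtain ⟨B, hB, -, hBb⟩ := exists_nhds_basis_mk_le_character x
  obtain ⟨U, hU, -⟩ := hBb Set.univ isOpen_univ trivial
  exact (Cardinal.one_le_iff_ne_zero.2 (mk_ne_zero_iff.2 ⟨⟨U, hU⟩⟩)).trans hB

/-- A nonempty set of size at most `#I` is the range of a function on `I`. -/
theorem exists_range_eq_of_mk_le {X I : Type u} {A : Set X} (hA : A.Nonempty) (h : #A ≤ #I) :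
    ∃ f : I → X, Set.range f = A := by
  obtain ⟨e⟩ := h
  have := hA.to_subtype
  refine ⟨fun i => (Function.invFun e i : A), ?_⟩
  have hs : Function.Surjective (Function.invFun e) := Function.invFun_surjective e.injective
  change Set.range (Subtype.val ∘ Function.invFun e) = A
  rw [hs.range_comp, Subtype.range_coe]

/-- Every point has a downward directed system of open neighborhoods indexed by the finite subsets
of any large enough type. -/
theorem exists_antitone_nhds_basis {X I : Type u} [TopologicalSpace X] (h : character X ≤ #I)
    (x : X) : ∃ V : Finset I → Set X, Antitone V ∧ (∀ a, IsOpen (V a) ∧ x ∈ V a) ∧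
      ∀ U, IsOpen U → x ∈ U → ∃ a, V a ⊆ U := by
  obtain ⟨B, hB, hBo, hBb⟩ := exists_nhds_basis_mk_le_character x
  obtain ⟨U₀, hU₀, -⟩ := hBb Set.univ isOpen_univ trivial
  obtain ⟨g, rfl⟩ := exists_range_eq_of_mk_le ⟨U₀, hU₀⟩ (hB.trans h)
  rw [Set.forall_mem_range] at hBo
  refine ⟨fun a => ⋂ i ∈ a, g i, fun a b hab => ?_, fun a => ⟨?_, ?_⟩, fun U hU hx => ?_⟩
  · exact Set.biInter_subset_biInter_left hab
  · exact isOpen_biInter_finset fun i _ => (hBo i).1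
  · exact Set.mem_iInter₂.2 fun i _ => (hBo i).2
  · obtain ⟨_, ⟨i, rfl⟩, hWU⟩ := hBb U hU hx
    exact ⟨{i}, by simpa using hWU⟩

/-- The cardinal bound in terms of a neighborhood system indexed by the finite subsets of `I`. -/
theorem mk_le_two_power_of_nhds {X I : Type u} [TopologicalSpace X] [Nonempty X] [Infinite I]
    (hc : cellularity X ≤ #I) (hnh : nh X ≤ 2 ^ #I) (V : X → Finset I → Set X)
    (hanti : ∀ x, Antitone (V x)) (hV : ∀ x a, IsOpen (V x a) ∧ x ∈ V x a)
    (hbasis : ∀ x U, IsOpen U → x ∈ U → ∃ a, V x a ⊆ U) : #X ≤ 2 ^ #I := by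
  classical
  have hI : ℵ₀ ≤ #I := aleph0_le_mk I
  have h2 : ℵ₀ ≤ (2 : Cardinal.{u}) ^ #I := hI.trans (cantor _).le
  let w : Finset X × Finset I → Set X := fun j => ⋂ q ∈ j.1, V q j.2
  have hw : ∀ j, IsOpen (w j) := fun j => isOpen_biInter_finset fun q _ => (hV q j.2).1
  -- `σ` and `s` together encode an `I`-indexed family of sets of pairs with entries from `range s`.
  let 𝒢 : Set (Finset I × Finset I × Finset I) → (I → X) → Finset I → Set (Finset X × Finset I) :=
    fun σ s a => {j | ∃ e, (a, e, j.2) ∈ σ ∧ e.image s = j.1}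
  let C : Set (Finset I × Finset I × Finset I) → (I → X) → Finset I → Set X :=
    fun σ s a => (closure (⋃ j ∈ 𝒢 σ s a, w j))ᶜ
  have hop : ∀ σ s, ∃ f : Set I → X, (∀ a, (C σ s a).Nonempty) → ∃ A ⊆ Set.range f,
      Maximal (fun B : Set X => ∀ F : Finset X, (F : Set X) ⊆ B →
        ∀ a, (w (F, a) ∩ C σ s a).Nonempty) A := by
    intro σ s
    by_cases hC : ∀ a, (C σ s a).Nonempty
    swap
    · exact ⟨fun _ => Classical.arbitrary X, fun h => (hC h).elim⟩
    obtain ⟨A, hA⟩ := exists_maximal_forall_finset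
      (fun F : Finset X => ∀ a, (w (F, a) ∩ C σ s a).Nonempty) (by simpa [w] using hC)
    obtain rfl | hne := A.eq_empty_or_nonempty
    · exact ⟨fun _ => Classical.arbitrary X, fun _ => ⟨∅, Set.empty_subset _, hA⟩⟩
    have hfin : FinNonHausdorff X A := by
      refine ⟨hne, fun F hF _ U hU => ?_⟩
      choose! b hb using fun x hx => hbasis x (U x) (hU x hx).1 (hU x hx).2
      refine ((hA.prop F hF (F.biUnion b)).mono Set.inter_subset_left).mono ?_
      exact Set.iInter₂_mono fun x hx =>
        (hanti x (Finset.subset_biUnion_of_mem b hx)).trans (hb x hx)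
    obtain ⟨f, hf⟩ := exists_range_eq_of_mk_le (I := Set I) hne
      ((hfin.mk_le_nh.trans hnh).trans_eq (mk_set).symm)
    exact ⟨f, fun _ => ⟨A, hf.ge, hA⟩⟩
  choose f hf using hop
  obtain ⟨Y, hYne, hY, hYop⟩ := exists_closed_under_mk_le (I := I)
    (S := Set (Finset I × Finset I × Finset I) × Set I)
    (by simp [mk_finset_of_infinite, mul_eq_self hI, mul_eq_self h2])
    (fun t s => f t.1 s t.2)
  suffices Y = Set.univ by rwa [this, mk_univ] at hY
  refine Set.eq_univ_of_forall fun p => by_contra fun hp => ?_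
  choose G hGsub hGc hG using fun a => exists_subset_mk_le_cellularity w
    {j : Finset X × Finset I | (j.1 : Set X) ⊆ Y ∧ Disjoint (w j) (V p a)} fun j _ => hw j
  simp only [lift_id] at hGc
  obtain ⟨s, hsY, hs⟩ : ∃ s : I → X, (∀ i, s i ∈ Y) ∧
      ∀ a, ∀ j ∈ G a, (j.1 : Set X) ⊆ Set.range s := by
    obtain ⟨y, hy⟩ := hYne
    let P : Set X := insert y (⋃ a, ⋃ j : G a, ((j : Finset X × Finset I).1 : Set X))
    have hP : #P ≤ #I := by
      refine mk_insert_le.trans (add_le_of_le hI ?_ (one_le_aleph0.trans hI))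
      refine (mk_iUnion_le _).trans ?_
      rw [mk_finset_of_infinite]
      refine (mul_le_mul_right (ciSup_le' fun a => ?_) _).trans (mul_eq_self hI).le
      refine (mk_iUnion_le _).trans ?_
      refine (mul_le_mul' ((hGc a).trans hc) (ciSup_le' fun j => ?_)).trans (mul_eq_self hI).le
      exact (Finset.finite_toSet _).lt_aleph0.le.trans hI
    obtain ⟨s, hs⟩ := exists_range_eq_of_mk_le (Set.insert_nonempty _ _) hP
    refine ⟨s, fun i => ?_, fun a j hj => ?_⟩
    · obtain h | h := hs.le (Set.mem_range_self i)
      · exact h ▸ hy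
      · obtain ⟨a, h⟩ := Set.mem_iUnion.1 h
        obtain ⟨j, h⟩ := Set.mem_iUnion.1 h
        exact (hGsub a j.2).1 h
    · rw [hs]
      exact (Set.subset_iUnion_of_subset a
        (Set.subset_iUnion (fun j : G a => ((j : Finset X × Finset I).1 : Set X))
          ⟨j, hj⟩)).trans (Set.subset_insert _ _)
  let σ : Set (Finset I × Finset I × Finset I) := {t | (t.2.1.image s, t.2.2) ∈ G t.1}
  have hσ : ∀ a, 𝒢 σ s a = G a := by
    refine fun a => Set.ext fun j => ⟨?_, fun hj => ?_⟩
    · rintro ⟨e, he, hej⟩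
      have : (e.image s, j.2) ∈ G a := he
      rwa [hej] at this
    · obtain ⟨e, -, he⟩ := Finset.subset_set_image_iff.1 (Set.image_univ.symm ▸ hs a j hj)
      refine ⟨e, ?_, he⟩
      change (e.image s, j.2) ∈ G a
      rwa [he]
  have hpC : ∀ a, V p a ⊆ C σ s a := by
    intro a
    refine Set.subset_compl_comm.1 (closure_minimal ?_ (hV p a).1.isClosed_compl)
    rw [hσ]
    exact Set.iUnion₂_subset fun j hj => (hGsub a hj).2.subset_compl_right
  obtain ⟨A, hAr, hA⟩ := hf σ s fun a => ⟨p, hpC a (hV p a).2⟩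
  have hAY : A ⊆ Y := hAr.trans (Set.range_subset_iff.2 fun i => hYop (σ, i) s hsY)
  refine hp (hAY (hA.le_of_ge (y := insert p A) ?_ (Set.subset_insert _ _) (Set.mem_insert _ _)))
  intro F hF a
  have hFY : ((F.erase p : Finset X) : Set X) ⊆ A := fun x hx => by
    obtain ⟨hxp, hx⟩ := Finset.mem_erase.1 hx
    exact (hF hx).resolve_left hxp
  have hnd : ¬ Disjoint (w (F.erase p, a)) (V p a) := by
    intro hd
    obtain ⟨z, hz, hzC⟩ := hA.prop (F.erase p) hFY a
    refine hzC ?_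
    rw [hσ]
    exact hG a (F.erase p, a) ⟨hFY.trans hAY, hd⟩ hz
  obtain ⟨z, hz, hzp⟩ := Set.not_disjoint_iff.1 hnd
  refine ⟨z, Set.mem_iInter₂.2 fun x hx => ?_, hpC a hzp⟩
  by_cases hxp : x = p
  · exact hxp ▸ hzp
  · exact Set.mem_iInter₂.1 hz x (Finset.mem_erase.2 ⟨hxp, hx⟩)

theorem statement1 (X : Type*) [TopologicalSpace X] [Infinite X]
    (h : nh X ≤ 2 ^ (cellularity X * character X)) :
    #X ≤ 2 ^ (cellularity X * character X) := by
  obtain ⟨I, hI⟩ : ∃ I, #I = cellularity X * character X := ⟨_, mk_out _⟩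
  have hω : ℵ₀ ≤ cellularity X := self_le_add_right _ _
  have hc : cellularity X ≤ #I := hI ▸ le_mul_of_one_le_right' (one_le_character X)
  have hχ : character X ≤ #I := hI ▸ le_mul_of_one_le_left' (one_le_aleph0.trans hω)
  have : Infinite I := infinite_iff.2 (hω.trans hc)
  choose V hV using exists_antitone_nhds_basis (X := X) hχ
  rw [← hI] at h ⊢
  exact mk_le_two_power_of_nhds hc h V (fun x => (hV x).1) (fun x => (hV x).2.1)
    fun x => (hV x).2.2
end

section
/- Let X be an infinite T1 topological space such that nu_s(X) ≤ 2^(s(X)). Then |X| ≤ 2^(2^(s(X))). -/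
open Cardinal Set

universe u

/-- Greedy construction along a well-ordering: a point is selected iff it satisfies `P` relative
to the set of points selected before it. -/
theorem exists_set_mem_iff_of_wellOrdering {α : Type*} (P : α → Set α → Prop) :
    ∃ D : Set α, ∀ x, x ∈ D ↔ P x {y | y ∈ D ∧ WellOrderingRel y x} := by
  have wf : WellFounded (WellOrderingRel (α := α)) := WellOrderingRel.isWellOrder.wf
  let D : α → Prop := wf.fix fun x ih => P x {y | ∃ h : WellOrderingRel y x, ih y h}
  refine ⟨{x | D x}, fun x => ?_⟩
  have hx : D x = P x {y | ∃ _ : WellOrderingRel y x, D y} := wf.fix_eq _ x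
  have hs : {y | ∃ _ : WellOrderingRel y x, D y} =
      {y | y ∈ {x | D x} ∧ WellOrderingRel y x} := by
    ext y
    simp [and_comm]
  rw [hs] at hx
  exact iff_of_eq hx

/-- Shapirovskii's covering lemma: if every discrete subspace has at most `#K` points, then a
nonempty set `S` with a neighbourhood assignment `U` is covered by the closure of some family of
`#K` points of `S` together with the neighbourhoods assigned to them. -/
theorem exists_family_subset_closure_union {X K : Type u} [TopologicalSpace X]
    (hK : ∀ D : Set X, DiscreteTopology D → #D ≤ #K) {S : Set X} (hS : S.Nonempty)
    (U : X → Set X) (hU : ∀ x ∈ S, IsOpen (U x) ∧ x ∈ U x) :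
    ∃ f : K → X, (∀ k, f k ∈ S) ∧ ∀ x ∈ S, x ∈ closure (range f) ∨ ∃ k, x ∈ U (f k) := by
  obtain ⟨D, hD⟩ := exists_set_mem_iff_of_wellOrdering
    fun (x : X) T => x ∈ S ∧ x ∉ closure T ∧ ∀ y ∈ T, x ∉ U y
  have hDS : D ⊆ S := fun x hx => ((hD x).1 hx).1
  have hcov : ∀ x ∈ S, x ∈ closure D ∨ ∃ y ∈ D, x ∈ U y := by
    intro x hx
    by_contra! hcon
    refine hcon.2 x ((hD x).2 ⟨hx, fun h => hcon.1 (closure_mono (fun y hy => hy.1) h),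
      fun y hy => hcon.2 y hy.1⟩) (hU x hx).2
  have hdisc : DiscreteTopology D := by
    rw [discreteTopology_subtype_iff']
    intro x hx
    obtain ⟨hxS, hxc, -⟩ := (hD x).1 hx
    refine ⟨U x ∩ (closure {y | y ∈ D ∧ WellOrderingRel y x})ᶜ,
      (hU x hxS).1.inter isClosed_closure.isOpen_compl, ?_⟩
    ext z
    constructor
    · rintro ⟨⟨hzU, hzc⟩, hzD⟩
      rcases trichotomous_of (WellOrderingRel (α := X)) z x with h | h | h
      · exact (hzc (subset_closure ⟨hzD, h⟩)).elim
      · exact h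
      · exact (((hD z).1 hzD).2.2 x ⟨hx, h⟩ hzU).elim
    · rintro rfl
      exact ⟨⟨(hU _ hxS).2, hxc⟩, hx⟩
  have hne : Nonempty D := by
    obtain ⟨x, hx⟩ := hS
    rcases hcov x hx with h | ⟨y, hy, -⟩
    · exact (closure_nonempty_iff.1 ⟨x, h⟩).to_subtype
    · exact ⟨⟨y, hy⟩⟩
  obtain ⟨e⟩ := hK D hdisc
  obtain ⟨g, he⟩ : ∃ g : K → D, Function.Surjective g :=
    ⟨_, Function.invFun_surjective e.injective⟩
  have hr : range (fun k => (g k : X)) = D := by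
    change range ((↑) ∘ g) = D
    rw [he.range_comp, Subtype.range_coe]
  refine ⟨fun k => g k, fun k => hDS (g k).2, fun x hx => ?_⟩
  rw [hr]
  refine (hcov x hx).imp_right ?_
  rintro ⟨y, hy, hxy⟩
  obtain ⟨k, hk⟩ := he ⟨y, hy⟩
  exact ⟨k, by simpa only [hk] using hxy⟩

/-- A family of at most `c` operations of arity `K` admits a nonempty closed set of size at most
`c`, provided `c ^ #K ≤ c`. -/
theorem exists_nonempty_closed_under_operations {X I K : Type u} [Nonempty X] {c : Cardinal.{u}}
    (hc : ℵ₀ ≤ c) (hI : #I ≤ c) (hK : c ^ #K ≤ c) (op : I → (K → X) → X) :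
    ∃ S : Set X, S.Nonempty ∧ #S ≤ c ∧ ∀ i f, (∀ k, f k ∈ S) → op i f ∈ S := by
  let β : Option I → Type u := fun o => o.elim PEmpty fun _ => K
  let ev : WType β → X := WType.elim X fun p =>
    match p with
    | ⟨none, _⟩ => Classical.arbitrary X
    | ⟨some i, f⟩ => op i f
  have hW : #(WType β) ≤ c := by
    apply WType.cardinalMk_le_of_le'
    simp only [lift_id]
    have hterm : ∀ o, c ^ #(β o) ≤ c := by
      rintro (_ | i)
      · simpa [β] using one_le_aleph0.trans hc
      · exact hK
    calc sum (fun o => c ^ #(β o)) ≤ sum (fun _ : Option I => c) := sum_le_sum _ _ hterm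
      _ = (#I + 1) * c := by simp
      _ ≤ c := mul_le_of_le hc (add_le_of_le hc hI (one_le_aleph0.trans hc)) le_rfl
  refine ⟨range ev, ⟨_, ⟨.mk none PEmpty.elim, rfl⟩⟩, mk_range_le.trans hW, fun i f hf => ?_⟩
  choose w hw using hf
  exact ⟨.mk (some i) w, congrArg (op i) (funext hw)⟩

/-- In a Hausdorff space, a point of the closure of a set is determined by the traces of its
neighbourhoods on that set. -/
theorem injOn_nhds_trace_closure {X K : Type*} [TopologicalSpace X] [T2Space X] (f : K → X) :
    InjOn (fun x => {T : Set K | ∃ U : Set X, IsOpen U ∧ x ∈ U ∧ f ⁻¹' U = T})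
      (closure (range f)) := by
  intro x _ y hy hxy
  by_contra hne
  obtain ⟨U, V, hU, hV, hxU, hyV, hUV⟩ := t2_separation hne
  have hmem : f ⁻¹' U ∈ {T : Set K | ∃ W : Set X, IsOpen W ∧ y ∈ W ∧ f ⁻¹' W = T} :=
    (Set.ext_iff.1 hxy (f ⁻¹' U)).1 ⟨U, hU, hxU, rfl⟩
  obtain ⟨W, hW, hyW, hWU⟩ := hmem
  obtain ⟨_, ⟨hzW, hzV⟩, k, rfl⟩ := mem_closure_iff.1 hy (W ∩ V) (hW.inter hV) ⟨hyW, hyV⟩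
  exact disjoint_left.1 hUV (show k ∈ f ⁻¹' U from hWU ▸ hzW) hzV

/-- The Hajnal–Juhász inequality for Hausdorff spaces. -/
theorem mk_le_two_power_two_power_of_discrete_le {X : Type u} [TopologicalSpace X] [T2Space X]
    {κ : Cardinal.{u}} (hκ : ℵ₀ ≤ κ) (hD : ∀ D : Set X, DiscreteTopology D → #D ≤ κ) :
    #X ≤ 2 ^ ((2 : Cardinal) ^ κ) := by
  induction κ using Cardinal.inductionOn with | _ K
  have hκ2 : #K ≤ 2 ^ #K := (cantor _).le
  have h22 : #K ≤ 2 ^ ((2 : Cardinal) ^ #K) := hκ2.trans (cantor _).le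
  have hc : ℵ₀ ≤ (2 : Cardinal) ^ ((2 : Cardinal) ^ #K) := hκ.trans h22
  rcases subsingleton_or_nontrivial X with hX | hX
  · exact (le_one_iff_subsingleton.2 hX).trans (one_le_aleph0.trans hc)
  have : Nonempty K := mk_ne_zero_iff.1 (aleph0_pos.trans_le hκ).ne'
  have hpt : ∀ q : X, ∃ (a : K → X) (V : K → Set X), (∀ k, q ∉ closure (V k)) ∧
      ∀ x, x ≠ q → x ∈ closure (range a) ∨ ∃ k, x ∈ V k := by
    intro q
    have hsep : ∀ x : X, ∃ V : Set X, x ≠ q → IsOpen V ∧ x ∈ V ∧ q ∉ closure V := by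
      intro x
      by_cases hx : x = q
      · exact ⟨∅, fun h => (h hx).elim⟩
      · obtain ⟨U, V, hU, hV, hxU, hqV, hUV⟩ := t2_separation hx
        exact ⟨U, fun _ => ⟨hU, hxU, fun h =>
          disjoint_left.1 (hUV.closure_left hV) h hqV⟩⟩
    choose V hV using hsep
    obtain ⟨a, ha, hcov⟩ := exists_family_subset_closure_union hD (S := {x | x ≠ q})
      (exists_ne q) V fun x hx => ⟨(hV x hx).1, (hV x hx).2.1⟩
    exact ⟨a, fun k => V (a k), fun k => (hV _ (ha k)).2.2, hcov⟩
  choose a V hqV hcov using hpt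
  let out : (K → K) → (K → X) → Set X := fun j f =>
    {x | x ∉ closure (range f) ∧ ∀ k, x ∈ closure (V (f k) (j k))}
  let op : Set (Set K) ⊕ (K → K) ⊕ K → (K → X) → X := fun i f =>
    match i with
    | .inl t => Function.invFunOn
        (fun x => {T : Set K | ∃ U : Set X, IsOpen U ∧ x ∈ U ∧ f ⁻¹' U = T})
        (closure (range f)) t
    | .inr (.inl j) => Classical.epsilon (out j f)
    | .inr (.inr k) => a (f (Classical.arbitrary K)) k
  have hI : #(Set (Set K) ⊕ (K → K) ⊕ K) ≤ 2 ^ ((2 : Cardinal) ^ #K) := by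
    simp only [mk_sum, mk_set, lift_id, mk_arrow]
    refine add_le_of_le hc le_rfl (add_le_of_le hc ?_ h22)
    rw [power_self_eq hκ]
    exact (cantor _).le
  have hpow : ((2 : Cardinal) ^ ((2 : Cardinal) ^ #K)) ^ #K ≤ 2 ^ ((2 : Cardinal) ^ #K) := by
    rw [← power_mul, mul_eq_left (hκ.trans hκ2) hκ2 (aleph0_pos.trans_le hκ).ne']
  obtain ⟨S, hSne, hScard, hop⟩ := exists_nonempty_closed_under_operations hc hI hpow op
  have hcl : ∀ f : K → X, (∀ k, f k ∈ S) → closure (range f) ⊆ S := by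
    intro f hf x hx
    rw [← (injOn_nhds_trace_closure f).leftInvOn_invFunOn hx]
    exact hop (.inl _) f hf
  suffices hS : ∀ p, p ∈ S by
    rw [← mk_univ, ← eq_univ_of_forall hS]
    exact hScard
  by_contra! hp
  obtain ⟨p, hp⟩ := hp
  have hj : ∀ q : X, ∃ k, q ∈ S → p ∈ V q k := by
    intro q
    by_cases hq : q ∈ S
    · rcases hcov q p (fun h => hp (h ▸ hq)) with h | ⟨k, hk⟩
      · exact (hp (hcl (a q) (fun k => hop (.inr (.inr k)) (fun _ => q) fun _ => hq) h)).elim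
      · exact ⟨k, fun _ => hk⟩
    · exact ⟨Classical.arbitrary K, fun h => (hq h).elim⟩
  choose j hj using hj
  obtain ⟨f, hfS, hf⟩ := exists_family_subset_closure_union hD hSne
    (fun q => (closure (V q (j q)))ᶜ)
    fun q _ => ⟨isClosed_closure.isOpen_compl, hqV q _⟩
  have hpout : p ∈ out (fun k => j (f k)) f :=
    ⟨fun h => hp (hcl f hfS h), fun k => subset_closure (hj _ (hfS k))⟩
  have hz : Classical.epsilon (out (fun k => j (f k)) f) ∈ out (fun k => j (f k)) f :=
    Classical.epsilon_spec (p := out (fun k => j (f k)) f) ⟨p, hpout⟩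
  rcases hf _ (hop (.inr (.inl fun k => j (f k))) f hfS) with h | ⟨k, hk⟩
  · exact hz.1 h
  · exact hk (hz.2 k)

theorem mem_thetaClosSingleton_comm {X : Type*} [TopologicalSpace X] {x y : X} :
    y ∈ thetaClosSingleton X x ↔ x ∈ thetaClosSingleton X y := by
  have key : ∀ x y : X, y ∈ thetaClosSingleton X x → x ∈ thetaClosSingleton X y := by
    intro x y h U hU hxU
    refine mem_closure_iff.2 fun W hW hyW => ?_
    rw [inter_comm]
    exact mem_closure_iff.1 (h W hW hyW) U hU hxU
  exact ⟨key x y, key y x⟩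

theorem mk_thetaClosSingleton_le_nuS {X : Type*} [TopologicalSpace X] (x : X) :
    #(thetaClosSingleton X x) ≤ nuS X :=
  (le_ciSup (f := fun x : X => #(thetaClosSingleton X x)) bddAbove_of_small x).trans
    le_add_self

theorem mk_le_spread {X : Type*} [TopologicalSpace X] (D : Set X) (hD : DiscreteTopology D) :
    #D ≤ spread X :=
  (le_ciSup (f := fun D : {D : Set X // DiscreteTopology D} => #D.1) bddAbove_of_small
    ⟨D, hD⟩).trans le_add_self

theorem statement3 (X : Type*) [TopologicalSpace X] [T1Space X] [Infinite X]
    (h : nuS X ≤ 2 ^ spread X) :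
    #X ≤ 2 ^ ((2 : Cardinal) ^ spread X) := by
  have hκ : ℵ₀ ≤ spread X := le_self_add
  obtain ⟨Y, hY⟩ := exists_set_mem_iff_of_wellOrdering
    fun (x : X) T => ∀ y ∈ T, y ∉ thetaClosSingleton X x
  have hsep : ∀ x ∈ Y, ∀ y ∈ Y, x ≠ y → y ∉ thetaClosSingleton X x := by
    intro x hx y hy hne
    rcases trichotomous_of (WellOrderingRel (α := X)) x y with h | h | h
    · rw [mem_thetaClosSingleton_comm]
      exact (hY y).1 hy x ⟨hx, h⟩
    · exact (hne h).elim
    · exact (hY x).1 hx y ⟨hy, h⟩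
  have hT2 : T2Space Y := by
    refine ⟨fun x y hne => ?_⟩
    have hxy := hsep x x.2 y y.2 (Subtype.coe_ne_coe.2 hne)
    simp only [thetaClosSingleton, mem_ofPred_eq, not_forall] at hxy
    obtain ⟨U, hU, hyU, hxU⟩ := hxy
    exact ⟨Subtype.val ⁻¹' (closure U)ᶜ, Subtype.val ⁻¹' U,
      isClosed_closure.isOpen_compl.preimage continuous_subtype_val,
      hU.preimage continuous_subtype_val, hxU, hyU,
      (disjoint_compl_left.mono_right subset_closure).preimage _⟩
  have hYcard : #Y ≤ 2 ^ ((2 : Cardinal) ^ spread X) := by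
    refine mk_le_two_power_two_power_of_discrete_le hκ fun D hD => ?_
    rw [← mk_image_eq (s := D) Subtype.val_injective]
    refine mk_le_spread _ ?_
    exact (Topology.IsEmbedding.subtypeVal.homeomorphImage D).symm.isEmbedding.discreteTopology
  have hcov : (⋃ y : Y, thetaClosSingleton X y) = Set.univ := by
    refine eq_univ_of_forall fun x => mem_iUnion.2 ?_
    by_cases hx : x ∈ Y
    · exact ⟨⟨x, hx⟩, fun U _ hxU => subset_closure hxU⟩
    · rw [hY] at hx
      push Not at hx
      obtain ⟨y, hy, hyx⟩ := hx
      exact ⟨⟨y, hy.1⟩, mem_thetaClosSingleton_comm.1 hyx⟩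
  have hle : (2 : Cardinal) ^ spread X ≤ 2 ^ ((2 : Cardinal) ^ spread X) := (cantor _).le
  have hc : ℵ₀ ≤ (2 : Cardinal) ^ ((2 : Cardinal) ^ spread X) :=
    hκ.trans ((cantor _).le.trans hle)
  rw [← mk_univ, ← hcov]
  refine (mk_iUnion_le_sum_mk).trans ((sum_le_sum _ (fun _ : Y => 2 ^ ((2 : Cardinal) ^ spread X))
    fun y => (mk_thetaClosSingleton_le_nuS (y : X)).trans (h.trans hle)).trans ?_)
  rw [sum_const']
  exact mul_le_of_le hc hYcard le_rfl
end

section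
/- Let X be a topological space and x ∈ X. Then cl_θ({x}) = ⋃{M : M a maximal finitely non-Hausdorff subset of X with x ∈ M}. -/
open Cardinal Set

theorem FinNonHausdorff.exists_maximal_superset {X : Type*} [TopologicalSpace X] {A : Set X}
    (hA : FinNonHausdorff X A) : ∃ M, A ⊆ M ∧ MaxFinNonHausdorff X M := by
  obtain ⟨M, hAM, hM⟩ := zorn_subset_nonempty {B | FinNonHausdorff X B} (fun c hc hchain hne => by
    refine ⟨⋃₀ c, ⟨?_, fun F hF hFne U hU => ?_⟩, fun s hs => subset_sUnion_of_mem hs⟩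
    · obtain ⟨s, hs⟩ := hne
      exact (hc hs).1.mono (subset_sUnion_of_mem hs)
    · obtain ⟨s, hs, hFs⟩ :=
        hchain.directedOn.exists_mem_subset_of_finite_of_subset_sUnion hne F.finite_toSet hF
      exact (hc hs).2 F hFs hFne U hU) A hA
  exact ⟨M, hAM, hM.prop, fun B hB hMB => hM.eq_of_subset hB hMB⟩

theorem finNonHausdorff_pair {X : Type*} [TopologicalSpace X] {x y : X}
    (hy : y ∈ thetaClosSingleton X x) : FinNonHausdorff X {x, y} := by
  classical
  refine ⟨insert_nonempty _ _, fun F hF _ U hU => ?_⟩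
  let V : X → Set X := fun a => if a ∈ F then U a else univ
  have hV : ∀ a, IsOpen (V a) ∧ a ∈ V a := fun a => by
    by_cases ha : a ∈ F
    · simpa [V, ha] using hU a ha
    · simp [V, ha]
  obtain ⟨z, hzx, hzy⟩ :=
    mem_closure_iff.1 (hy (V y) (hV y).1 (hV y).2) (V x) (hV x).1 (hV x).2
  refine ⟨z, mem_iInter₂.2 fun a ha => ?_⟩
  have hza : z ∈ V a := by
    rcases hF ha with rfl | rfl
    · exact hzx
    · exact hzy
  simpa [V, ha] using hza

theorem FinNonHausdorff.mem_thetaClosSingleton {X : Type*} [TopologicalSpace X] {A : Set X}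
    (hA : FinNonHausdorff X A) {x y : X} (hx : x ∈ A) (hy : y ∈ A) :
    y ∈ thetaClosSingleton X x := by
  classical
  intro U hU hyU
  refine mem_closure_iff.2 fun W hW hxW => ?_
  let V : X → Set X := fun a => {z | (a = x → z ∈ W) ∧ (a = y → z ∈ U)}
  have hV : ∀ a, IsOpen (V a) ∧ a ∈ V a := fun a => by
    refine ⟨IsOpen.inter (s := {z | a = x → z ∈ W}) (t := {z | a = y → z ∈ U})
      ?_ ?_, ?_, ?_⟩
    · by_cases h : a = x <;> simp [h, hW]
    · by_cases h : a = y <;> simp [h, hU]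
    · rintro rfl
      exact hxW
    · rintro rfl
      exact hyU
  obtain ⟨z, hz⟩ := hA.2 {x, y} (by simp [insert_subset_iff, hx, hy]) (by simp) V
    fun a _ => hV a
  rw [mem_iInter₂] at hz
  exact ⟨z, (hz x (by simp)).1 rfl, (hz y (by simp)).2 rfl⟩

theorem statement15 (X : Type*) [TopologicalSpace X] (x : X) :
    thetaClosSingleton X x =
      ⋃ (M : Set X) (_ : MaxFinNonHausdorff X M ∧ x ∈ M), M := by
  ext y
  simp only [mem_iUnion, exists_prop]
  constructor
  · intro hy
    obtain ⟨M, hM, hmax⟩ := (finNonHausdorff_pair hy).exists_maximal_superset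
    exact ⟨M, ⟨hmax, hM (by simp)⟩, hM (by simp)⟩
  · rintro ⟨M, ⟨hM, hx⟩, hy⟩
    exact hM.1.mem_thetaClosSingleton hx hy
end
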